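/- arXiv:2312.01647 — 2 statements merged into one kernel-verified Lean document; each statement's English description precedes it below -/
import Mathlib

section
/- Let S and T be finite sets of positive integers with T ⪯ S, and let x be a positive integer such that |T_{<x}| = |S_{≤x}|. Then for every index j with 1 ≤ j ≤ |T_{<x}| one has (T ◁ S)(j) = T(j). (Note that |T_{<x}| = |S_{≤x}| ≤ |S| = |T ◁ S|, so the index is valid.) -/
/-- The `◁` operator: `tri T S = T ◁ S`.  Iterate through the elements of `S` from
largest to smallest; the current element `s` picks the largest element of `T` that is
less than `s` and has not yet been picked (if such an element exists), and the picked
elements form `T ◁ S`. -/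
def tri (T S : Finset ℕ) : Finset ℕ :=
  if hS : S.Nonempty then
    if hT : (T.filter (fun t => t < S.max' hS)).Nonempty then
      insert ((T.filter (fun t => t < S.max' hS)).max' hT)
        (tri (T.filter (fun t => t < (T.filter (fun t => t < S.max' hS)).max' hT))
          (S.erase (S.max' hS)))
    else ∅
  else ∅
termination_by S.card
decreasing_by
  exact Finset.card_erase_lt_of_mem (S.max'_mem hS)

/-- `nth S i` is the `i`-th smallest element of `S` (1-based), i.e. `S(i)`. -/
def nth (S : Finset ℕ) (i : ℕ) : ℕ :=
  (S.sort (· ≤ ·)).getD (i - 1) 0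

/-- `Dom T S` means `T ⪯ S`, i.e. `S` dominates `T`:
`|T| ≥ |S|` and `T(i) < S(i)` for all `1 ≤ i ≤ |S|`. -/
def Dom (T S : Finset ℕ) : Prop :=
  S.card ≤ T.card ∧ ∀ i, 1 ≤ i → i ≤ S.card → nth T i < nth S i

theorem my_sort_append (A B C : Finset ℕ) (h : ∀ a, a ∈ C ↔ a ∈ A ∨ a ∈ B)
    (hlt : ∀ a ∈ A, ∀ b ∈ B, a < b) :
    C.sort (· ≤ ·) = A.sort (· ≤ ·) ++ B.sort (· ≤ ·) := by
  have hd : Disjoint A B := Finset.disjoint_left.mpr fun a ha hb => lt_irrefl _ (hlt a ha a hb)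
  refine List.Perm.eq_of_pairwise (le := (· ≤ ·)) ?_ (Finset.pairwise_sort _ _) ?_ ?_
  · intro a b _ _ h1 h2; exact le_antisymm h1 h2
  · rw [List.pairwise_append]
    refine ⟨Finset.pairwise_sort _ _, Finset.pairwise_sort _ _, ?_⟩
    intro a ha b hb
    exact (hlt a ((Finset.mem_sort _).1 ha) b ((Finset.mem_sort _).1 hb)).le
  · rw [List.perm_ext_iff_of_nodup (Finset.sort_nodup _ _)]
    · intro a; simp [h]
    · rw [List.nodup_append]
      refine ⟨Finset.sort_nodup _ _, Finset.sort_nodup _ _, ?_⟩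
      intro a ha b hb
      exact (hlt a ((Finset.mem_sort _).1 ha) b ((Finset.mem_sort _).1 hb)).ne

theorem my_nth_initial (A B C : Finset ℕ) (h : ∀ a, a ∈ C ↔ a ∈ A ∨ a ∈ B)
    (hlt : ∀ a ∈ A, ∀ b ∈ B, a < b) (j : ℕ) (h1 : 1 ≤ j) (h2 : j ≤ A.card) :
    nth C j = nth A j := by
  unfold nth
  rw [my_sort_append A B C h hlt, List.getD_append]
  rw [Finset.length_sort]; omega

theorem my_nth_mem (A : Finset ℕ) (j : ℕ) (h1 : 1 ≤ j) (h2 : j ≤ A.card) : nth A j ∈ A := by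
  unfold nth
  have : j - 1 < (A.sort (· ≤ ·)).length := by rw [Finset.length_sort]; omega
  rw [List.getD_eq_getElem _ _ this]
  exact (Finset.mem_sort (· ≤ ·)).1 (List.getElem_mem _)

theorem my_nth_inj (A : Finset ℕ) (i j : ℕ) (h1 : 1 ≤ i) (h2 : i ≤ A.card)
    (h3 : 1 ≤ j) (h4 : j ≤ A.card) (h : nth A i = nth A j) : i = j := by
  unfold nth at h
  have hi : i - 1 < (A.sort (· ≤ ·)).length := by rw [Finset.length_sort]; omega
  have hj : j - 1 < (A.sort (· ≤ ·)).length := by rw [Finset.length_sort]; omega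
  rw [List.getD_eq_getElem _ _ hi, List.getD_eq_getElem _ _ hj,
    (Finset.sort_nodup A (· ≤ ·)).getElem_inj_iff] at h
  omega

theorem my_dom_count (S T : Finset ℕ) (hd : Dom T S) (y : ℕ) :
    (S.filter (· ≤ y)).card ≤ (T.filter (· < y)).card := by
  obtain ⟨hc, hd⟩ := hd
  have hk : (S.filter (· ≤ y)).card ≤ S.card := Finset.card_filter_le _ _
  have : (Finset.Icc 1 (S.filter (· ≤ y)).card).card ≤ (T.filter (· < y)).card := by
    refine Finset.card_le_card_of_injOn (nth T) ?_ ?_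
    · intro i hi
      have hi' := Finset.mem_Icc.1 (Finset.mem_coe.1 hi)
      have e : nth S i = nth (S.filter (· ≤ y)) i :=
        my_nth_initial _ (S.filter (y < ·)) _ (by intro a; simp only [Finset.mem_filter]; grind)
          (by intro a ha b hb; simp only [Finset.mem_filter] at ha hb; omega) i hi'.1 hi'.2
      have m := my_nth_mem (S.filter (· ≤ y)) i hi'.1 hi'.2
      rw [← e, Finset.mem_filter] at m
      have l := hd i hi'.1 (by omega)
      have mt := my_nth_mem T i hi'.1 (by omega)
      simp only [Finset.coe_filter, Set.mem_setOf_eq]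
      exact ⟨mt, by omega⟩
    · intro i hi j hj h
      have hi' := Finset.mem_Icc.1 (Finset.mem_coe.1 hi)
      have hj' := Finset.mem_Icc.1 (Finset.mem_coe.1 hj)
      exact my_nth_inj T i j hi'.1 (by omega) hj'.1 (by omega) h
  simpa using this

theorem my_tri_subset (n : ℕ) : ∀ S T : Finset ℕ, S.card = n → tri T S ⊆ T := by
  induction n with
  | zero =>
    intro S T h
    rw [Finset.card_eq_zero] at h
    subst h
    rw [tri]; simp
  | succ n ih =>
    intro S T h
    rw [tri]
    split_ifs with hS hT
    · have hm := Finset.max'_mem _ hT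
      refine Finset.insert_subset (Finset.mem_filter.1 hm).1 ?_
      refine (ih _ _ ?_).trans (Finset.filter_subset _ _)
      rw [Finset.card_erase_of_mem (Finset.max'_mem _ _)]; omega
    · simp
    · simp

theorem my_subset_tri (n : ℕ) : ∀ S T : Finset ℕ, S.card = n →
    (∀ y, (S.filter (· ≤ y)).card ≤ (T.filter (· < y)).card) → ∀ x,
    (T.filter (· < x)).card = (S.filter (· ≤ x)).card → T.filter (· < x) ⊆ tri T S := by
  induction n with
  | zero =>
    intro S T h hd x hc
    rw [Finset.card_eq_zero] at h
    subst h
    simp only [Finset.filter_empty, Finset.card_empty, Finset.card_eq_zero] at hc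
    rw [hc]; simp
  | succ n ih =>
    intro S T h hd x hc
    have hS : S.Nonempty := Finset.card_pos.1 (by omega)
    have hsS : ∀ a ∈ S, a ≤ S.max' hS := fun a ha => Finset.le_max' _ _ ha
    have hsm := S.max'_mem hS
    rw [tri, dif_pos hS]
    generalize S.max' hS = s at *
    have hall : ∀ y, s ≤ y → S.filter (· ≤ y) = S := fun y hy =>
      Finset.filter_true_of_mem fun a ha => (hsS a ha).trans hy
    have hds := hd s
    rw [hall s le_rfl] at hds
    have hT : (T.filter (fun t => t < s)).Nonempty := Finset.card_pos.1 (by omega)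
    rw [dif_pos hT]
    have htT : ∀ a ∈ T, a < s → a ≤ (T.filter (fun t => t < s)).max' hT :=
      fun a ha h => Finset.le_max' _ _ (Finset.mem_filter.2 ⟨ha, h⟩)
    have htm := Finset.mem_filter.1 (Finset.max'_mem _ hT)
    generalize (T.filter (fun t => t < s)).max' hT = t at *
    obtain ⟨htm, hts⟩ := htm
    have hTs : T.filter (· < s) = insert t (T.filter (· < t)) := by
      ext a; simp only [Finset.mem_filter, Finset.mem_insert]
      grind
    have hcT : (T.filter (· < s)).card = (T.filter (· < t)).card + 1 := by
      rw [hTs, Finset.card_insert_of_notMem (by simp)]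
    have hcS : (S.erase s).card = n := by rw [Finset.card_erase_of_mem hsm]; omega
    have hlow : ∀ y, y < s → (S.erase s).filter (· ≤ y) = S.filter (· ≤ y) := by
      intro y hy; ext a; simp only [Finset.mem_filter, Finset.mem_erase]; grind
    have hTle : ∀ y, y ≤ t → (T.filter (· < t)).filter (· < y) = T.filter (· < y) := by
      intro y hy; ext a; simp only [Finset.mem_filter]; grind
    have hTge : ∀ y, t ≤ y → (T.filter (· < t)).filter (· < y) = T.filter (· < t) := by
      intro y hy; ext a; simp only [Finset.mem_filter]; grind
    have key := ih (S.erase s) (T.filter (· < t)) hcS ?_ x ?_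
    · intro a ha
      have ha' := Finset.mem_filter.1 ha
      rcases lt_trichotomy a t with hat | hat | hat
      · exact Finset.mem_insert_of_mem (key (by simp only [Finset.mem_filter]; grind))
      · subst hat; exact Finset.mem_insert_self _ _
      · exfalso
        have has : s ≤ a := by
          by_contra hh
          have := htT a ha'.1 (by omega)
          omega
        rw [hall x (by omega)] at hc
        have : (insert a (T.filter (· < s))).card ≤ (T.filter (· < x)).card := by
          apply Finset.card_le_card
          intro b; simp only [Finset.mem_insert, Finset.mem_filter]; grind
        rw [Finset.card_insert_of_notMem (by simp only [Finset.mem_filter]; omega)] at this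
        omega
    · intro y
      by_cases hy : y ≤ t
      · rw [hTle y hy, hlow y (by omega)]; exact hd y
      · rw [hTge y (by omega)]
        have := Finset.card_filter_le (S.erase s) (· ≤ y)
        omega
    · by_cases hy : x ≤ t
      · rw [hTle x hy, hlow x (by omega)]; exact hc
      · rw [hTge x (by omega)]
        by_cases hxs : x < s
        · exfalso
          have e1 : T.filter (· < s) ⊆ T.filter (· < x) := by
            intro b; simp only [Finset.mem_filter]; grind
          have e2 := Finset.card_le_card e1
          have e3 : (S.filter (· ≤ x)).card < S.card := by
            apply Finset.card_lt_card
            rw [Finset.filter_ssubset]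
            exact ⟨s, hsm, by omega⟩
          omega
        · have e : (S.erase s).filter (· ≤ x) = S.erase s :=
            Finset.filter_true_of_mem fun a ha => by
              have := hsS a (Finset.mem_of_mem_erase ha)
              omega
          rw [e, hcS]
          rw [hall x (by omega)] at hc
          have e1 : (T.filter (· < s)).card ≤ (T.filter (· < x)).card := by
            apply Finset.card_le_card
            intro b; simp only [Finset.mem_filter]; grind
          omega

theorem stmt5 (S T : Finset ℕ) (hSpos : ∀ a ∈ S, 0 < a) (hTpos : ∀ a ∈ T, 0 < a)
    (hd : Dom T S) (x : ℕ) (hx : 0 < x)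
    (hc : (T.filter (· < x)).card = (S.filter (· ≤ x)).card) :
    ∀ j, 1 ≤ j → j ≤ (T.filter (· < x)).card → nth (tri T S) j = nth T j := by
  intro j h1 h2
  have hsub := my_tri_subset _ S T rfl
  have hsup := my_subset_tri _ S T rfl (my_dom_count S T hd) x hc
  rw [my_nth_initial (T.filter (· < x)) (T.filter (x ≤ ·)) T
      (by intro a; simp only [Finset.mem_filter]; grind)
      (by intro a ha b hb; simp only [Finset.mem_filter] at ha hb; omega) j h1 h2,
    my_nth_initial (T.filter (· < x)) ((tri T S).filter (x ≤ ·)) (tri T S) ?_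
      (by intro a ha b hb; simp only [Finset.mem_filter] at ha hb; omega) j h1 h2]
  intro a
  have e1 := @hsub a
  have e2 := @hsup a
  simp only [Finset.mem_filter] at e2 ⊢
  grind
end

section
/- Let S and T be finite sets of positive integers with T ⪯ S. Suppose there exists a positive integer x ∉ S such that |S_{<x}| = |T_{<x}|. Let y ∈ S with y < x and set S' = (S ⊔ x) − y. Then T ⪯ S', and for every index i such that S(i) < x one has (T ◁ S)(i) = (T ◁ S')(i) = T(i). -/
theorem nth_eq_emb (S : Finset ℕ) (i : ℕ) (h1 : 1 ≤ i) (h2 : i ≤ S.card) :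
    nth S i = S.orderEmbOfFin rfl ⟨i - 1, by omega⟩ := by
  unfold nth
  rw [Finset.orderEmbOfFin_apply]
  rw [List.getD_eq_getElem _ _ (by rw [Finset.length_sort]; omega)]
  rfl

theorem nth_mem' (S : Finset ℕ) (i : ℕ) (h1 : 1 ≤ i) (h2 : i ≤ S.card) : nth S i ∈ S := by
  rw [nth_eq_emb S i h1 h2]
  exact Finset.orderEmbOfFin_mem _ _ _

theorem nth_count (S : Finset ℕ) (i : ℕ) (h1 : 1 ≤ i) (h2 : i ≤ S.card) :
    (S.filter (· < nth S i)).card = i - 1 := by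
  rw [nth_eq_emb S i h1 h2]
  have : S.filter (· < S.orderEmbOfFin rfl ⟨i - 1, by omega⟩)
      = (Finset.Iio (⟨i - 1, by omega⟩ : Fin S.card)).map (S.orderEmbOfFin rfl).toEmbedding := by
    ext a
    simp only [Finset.mem_filter, Finset.mem_map, Finset.mem_Iio]
    constructor
    · rintro ⟨ha, hlt⟩
      have : a ∈ Set.range (S.orderEmbOfFin rfl) := by
        rw [Finset.range_orderEmbOfFin]; exact ha
      obtain ⟨k, rfl⟩ := this
      exact ⟨k, (S.orderEmbOfFin rfl).lt_iff_lt.mp hlt, rfl⟩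
    · rintro ⟨k, hk, rfl⟩
      exact ⟨Finset.orderEmbOfFin_mem _ _ _, (S.orderEmbOfFin rfl).lt_iff_lt.mpr hk⟩
  rw [this, Finset.card_map, Fin.card_Iio]

theorem count_mono (S : Finset ℕ) {a b : ℕ} (h : a ≤ b) :
    (S.filter (· < a)).card ≤ (S.filter (· < b)).card := by
  apply Finset.card_le_card
  intro c
  simp only [Finset.mem_filter]
  rintro ⟨h1, h2⟩
  exact ⟨h1, by omega⟩

theorem count_le_mem (S : Finset ℕ) {a : ℕ} (h : a ∈ S) :
    (S.filter (· ≤ a)).card = (S.filter (· < a)).card + 1 := by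
  have : S.filter (· ≤ a) = insert a (S.filter (· < a)) := by
    ext c
    simp only [Finset.mem_filter, Finset.mem_insert]
    constructor
    · rintro ⟨h1, h2⟩
      rcases Nat.lt_or_eq_of_le h2 with h3 | h3
      · exact Or.inr ⟨h1, h3⟩
      · exact Or.inl h3
    · rintro (rfl | ⟨h1, h2⟩)
      · exact ⟨h, le_rfl⟩
      · exact ⟨h1, h2.le⟩
  rw [this, Finset.card_insert_of_notMem (by simp)]

theorem count_le_lt (S : Finset ℕ) {a b : ℕ} (h : a < b) :
    (S.filter (· ≤ a)).card ≤ (S.filter (· < b)).card := by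
  apply Finset.card_le_card
  intro c
  simp only [Finset.mem_filter]
  rintro ⟨h1, h2⟩
  exact ⟨h1, by omega⟩

theorem count_lt_strict (S : Finset ℕ) {a b : ℕ} (ha : a ∈ S) (h : a < b) :
    (S.filter (· < a)).card < (S.filter (· < b)).card := by
  have h1 := count_le_mem S ha
  have h2 := count_le_lt S h
  omega

theorem nth_unique (S : Finset ℕ) (i a : ℕ) (h1 : 1 ≤ i) (ha : a ∈ S)
    (hc : (S.filter (· < a)).card = i - 1) : nth S i = a := by
  have h2 : i ≤ S.card := by
    have h3 := count_le_mem S ha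
    have h4 := Finset.card_le_card (Finset.filter_subset (· ≤ a) S)
    omega
  have hm := nth_mem' S i h1 h2
  have hn := nth_count S i h1 h2
  rcases lt_trichotomy (nth S i) a with h | h | h
  · have := count_lt_strict S hm h; omega
  · exact h
  · have := count_lt_strict S ha h; omega

/-- Counting form of domination. -/
def CD (T S : Finset ℕ) : Prop :=
  ∀ z, (S.filter (· ≤ z)).card ≤ (T.filter (· < z)).card

theorem cd_of_dom {T S : Finset ℕ} (h : Dom T S) : CD T S := by
  intro z
  rcases (S.filter (· ≤ z)).eq_empty_or_nonempty with he | hne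
  · rw [he]; simp
  · have hm := Finset.max'_mem _ hne
    have hmax : ∀ a ∈ S.filter (· ≤ z), a ≤ (S.filter (· ≤ z)).max' hne :=
      fun a ha => Finset.le_max' _ a ha
    generalize (S.filter (· ≤ z)).max' hne = s at hm hmax
    simp only [Finset.mem_filter] at hm hmax
    have e : S.filter (· ≤ z) = S.filter (· ≤ s) := by
      ext c
      simp only [Finset.mem_filter]
      exact ⟨fun hh => ⟨hh.1, hmax c hh⟩, fun hh => ⟨hh.1, hh.2.trans hm.2⟩⟩
    have h3 := count_le_mem S hm.1
    have h4 := Finset.card_le_card (Finset.filter_subset (· ≤ s) S)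
    rw [e]
    set i := (S.filter (· ≤ s)).card
    have hs := nth_unique S i s (by omega) hm.1 (by omega)
    have hl := h.2 i (by omega) h4
    have hiT : i ≤ T.card := h4.trans h.1
    have hmT := nth_mem' T i (by omega) hiT
    have hnT := nth_count T i (by omega) hiT
    have h5 := count_le_mem T hmT
    have h6 := count_le_lt T (a := nth T i) (b := z) (by omega)
    omega

theorem dom_of_cd {T S : Finset ℕ} (h : CD T S) : Dom T S := by
  have hcard : S.card ≤ T.card := by
    have h1 := h (S.sup id)
    have e : S.filter (· ≤ S.sup id) = S := by
      apply Finset.filter_true_of_mem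
      intro a ha
      exact Finset.le_sup (f := id) ha
    rw [e] at h1
    exact h1.trans (Finset.card_le_card (Finset.filter_subset _ _))
  refine ⟨hcard, fun i h1 h2 => ?_⟩
  by_contra hcon
  have hm := nth_mem' S i h1 h2
  have hn := nth_count S i h1 h2
  have h3 := count_le_mem S hm
  have h4 := h (nth S i)
  have hnT := nth_count T i h1 (h2.trans hcard)
  have h5 := count_mono T (a := nth S i) (b := nth T i) (by omega)
  omega

theorem tri_subset (n : ℕ) : ∀ T S : Finset ℕ, S.card = n → tri T S ⊆ T := by
  induction n with
  | zero =>
    intro T S h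
    have : S = ∅ := Finset.card_eq_zero.mp h
    subst this
    rw [tri]; simp
  | succ n ih =>
    intro T S h
    have hS : S.Nonempty := Finset.card_pos.mp (by omega)
    rw [tri, dif_pos hS]
    split_ifs with hT
    · apply Finset.insert_subset
      · exact (Finset.mem_filter.mp (Finset.max'_mem _ hT)).1
      · refine (ih _ _ ?_).trans (Finset.filter_subset _ _)
        rw [Finset.card_erase_of_mem (S.max'_mem hS)]; omega
    · simp

theorem tri_sup (x n : ℕ) : ∀ T S : Finset ℕ, S.card = n → CD T S →
    (S.filter (· ≤ x)).card = (T.filter (· < x)).card → T.filter (· < x) ⊆ tri T S := by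
  induction n with
  | zero =>
    intro T S h _ he
    have : S = ∅ := Finset.card_eq_zero.mp h
    subst this
    have : T.filter (· < x) = ∅ := by
      apply Finset.card_eq_zero.mp
      rw [← he]; simp
    rw [this]; simp
  | succ n ih =>
    intro T S h hcd he
    have hS : S.Nonempty := Finset.card_pos.mp (by omega)
    rw [tri, dif_pos hS]
    have hm := S.max'_mem hS
    have hmax : ∀ a ∈ S, a ≤ S.max' hS := fun a ha => Finset.le_max' S a ha
    generalize S.max' hS = m at hm hmax
    have hSm : S.filter (· ≤ m) = S := Finset.filter_true_of_mem hmax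
    have hTm := hcd m
    rw [hSm] at hTm
    have hT : (T.filter (fun t => t < m)).Nonempty := Finset.card_pos.mp (by omega)
    rw [dif_pos hT]
    have ht := Finset.max'_mem _ hT
    have htmax : ∀ a ∈ T.filter (fun t => t < m), a ≤ (T.filter (fun t => t < m)).max' hT :=
      fun a ha => Finset.le_max' _ a ha
    generalize (T.filter (fun t => t < m)).max' hT = t at ht htmax
    simp only [Finset.mem_filter] at ht htmax
    have e1 : T.filter (· < m) = T.filter (· ≤ t) := by
      ext c
      simp only [Finset.mem_filter]
      exact ⟨fun hh => ⟨hh.1, htmax c hh⟩, fun hh => ⟨hh.1, by omega⟩⟩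
    have hTt := count_le_mem T ht.1
    rw [← e1] at hTt
    have hSe : (S.erase m).card = n := by
      rw [Finset.card_erase_of_mem hm]; omega
    have e2 : ∀ z, z ≤ t → (T.filter (· < t)).filter (· < z) = T.filter (· < z) := by
      intro z hz
      ext c
      simp only [Finset.mem_filter]
      constructor
      · rintro ⟨⟨a, b⟩, d⟩; exact ⟨a, d⟩
      · rintro ⟨a, d⟩; exact ⟨⟨a, by omega⟩, d⟩
    have e3 : ∀ z, t ≤ z → (T.filter (· < t)).filter (· < z) = T.filter (· < t) := by
      intro z hz
      apply Finset.filter_true_of_mem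
      intro c hc
      have := (Finset.mem_filter.mp hc).2
      omega
    have hcd' : CD (T.filter (· < t)) (S.erase m) := by
      intro z
      rcases le_total z t with hz | hz
      · rw [e2 z hz]
        refine le_trans (Finset.card_le_card ?_) (hcd z)
        exact Finset.filter_subset_filter _ (Finset.erase_subset _ _)
      · rw [e3 z hz]
        have := Finset.card_le_card (Finset.filter_subset (· ≤ z) (S.erase m))
        omega
    rcases le_or_gt m x with hmx | hmx
    · have hSx : S.filter (· ≤ x) = S := Finset.filter_true_of_mem
        (fun a ha => (hmax a ha).trans hmx)
      rw [hSx] at he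
      have hsub : T.filter (· < m) ⊆ T.filter (· < x) := by
        intro c
        simp only [Finset.mem_filter]
        rintro ⟨a, b⟩; exact ⟨a, by omega⟩
      have heq := Finset.eq_of_subset_of_card_le hsub (by omega)
      have hxe : ((S.erase m).filter (· ≤ x)).card
          = ((T.filter (· < t)).filter (· < x)).card := by
        rw [e3 x (by omega), Finset.filter_true_of_mem
          (fun a ha => (hmax a (Finset.mem_of_mem_erase ha)).trans hmx)]
        rw [heq] at hTt
        omega
      have := ih _ _ hSe hcd' hxe
      rw [e3 x (by omega)] at this
      intro c hc
      rw [← heq, e1] at hc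
      have hc' := Finset.mem_filter.mp hc
      rw [Finset.mem_insert]
      rcases Nat.lt_or_eq_of_le hc'.2 with h3 | h3
      · exact Or.inr (this (Finset.mem_filter.mpr ⟨hc'.1, h3⟩))
      · exact Or.inl h3
    · have hxe0 : (S.erase m).filter (· ≤ x) = S.filter (· ≤ x) := by
        ext c
        simp only [Finset.mem_filter, Finset.mem_erase]
        constructor
        · rintro ⟨⟨a, b⟩, d⟩; exact ⟨b, d⟩
        · rintro ⟨a, d⟩; exact ⟨⟨by omega, a⟩, d⟩
      have hxt : x ≤ t := by
        by_contra hcon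
        have h7 := count_le_lt T (a := t) (b := x) (by omega)
        rw [← e1] at h7
        have h8 := Finset.card_le_card (Finset.filter_subset (· ≤ x) (S.erase m))
        rw [hxe0] at h8
        omega
      have := ih _ _ hSe hcd' (by rw [hxe0, e2 x hxt, he])
      rw [e2 x hxt] at this
      exact this.trans (Finset.subset_insert _ _)

theorem nth_tri (S T : Finset ℕ) (x : ℕ) (hcd : CD T S)
    (he : (S.filter (· ≤ x)).card = (T.filter (· < x)).card) (i : ℕ) (h1 : 1 ≤ i)
    (hi : i ≤ (T.filter (· < x)).card) : nth (tri T S) i = nth T i := by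
  have hsup := tri_sup x _ T S rfl hcd he
  have hsub := tri_subset _ T S rfl
  have hiT : i ≤ T.card := hi.trans (Finset.card_le_card (Finset.filter_subset _ _))
  have hm := nth_mem' T i h1 hiT
  have hn := nth_count T i h1 hiT
  have hlt : nth T i < x := by
    by_contra hcon
    have := count_mono T (a := x) (b := nth T i) (by omega)
    omega
  apply nth_unique _ _ _ h1
  · exact hsup (Finset.mem_filter.mpr ⟨hm, hlt⟩)
  · rw [← hn]
    congr 1
    ext c
    simp only [Finset.mem_filter]
    constructor
    · rintro ⟨a, b⟩; exact ⟨hsub a, b⟩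
    · rintro ⟨a, b⟩; exact ⟨hsup (Finset.mem_filter.mpr ⟨a, by omega⟩), b⟩

theorem stmt6 (S T : Finset ℕ) (hSpos : ∀ a ∈ S, 0 < a) (hTpos : ∀ a ∈ T, 0 < a)
    (hd : Dom T S) (x : ℕ) (hx : 0 < x) (hxS : x ∉ S)
    (hc : (S.filter (· < x)).card = (T.filter (· < x)).card)
    (y : ℕ) (hyS : y ∈ S) (hyx : y < x) :
    Dom T (insert x (S.erase y)) ∧
    ∀ i, 1 ≤ i → i ≤ S.card → nth S i < x →
      nth (tri T S) i = nth T i ∧ nth (tri T (insert x (S.erase y))) i = nth T i := by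
  have hcd := cd_of_dom hd
  have hge : ∀ z, x ≤ z →
      ((insert x (S.erase y)).filter (· ≤ z)).card = (S.filter (· ≤ z)).card := by
    intro z hz
    have e : (insert x (S.erase y)).filter (· ≤ z) = insert x ((S.filter (· ≤ z)).erase y) := by
      ext c
      simp only [Finset.mem_filter, Finset.mem_insert, Finset.mem_erase]
      constructor
      · rintro ⟨h | h, h'⟩
        · exact Or.inl h
        · exact Or.inr ⟨h.1, h.2, h'⟩
      · rintro (h | h)
        · exact ⟨Or.inl h, by omega⟩
        · exact ⟨Or.inr ⟨h.1, h.2.1⟩, h.2.2⟩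
    have hy : y ∈ S.filter (· ≤ z) := Finset.mem_filter.mpr ⟨hyS, by omega⟩
    rw [e, Finset.card_insert_of_notMem, Finset.card_erase_of_mem hy]
    · have := Finset.card_pos.mpr ⟨y, hy⟩
      omega
    · simp [hxS]
  have hcd' : CD T (insert x (S.erase y)) := by
    intro z
    rcases le_or_gt x z with hz | hz
    · rw [hge z hz]; exact hcd z
    · refine le_trans (Finset.card_le_card ?_) (hcd z)
      intro c
      simp only [Finset.mem_filter, Finset.mem_insert, Finset.mem_erase]
      rintro ⟨h | h, h'⟩
      · omega
      · exact ⟨h.2, h'⟩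
  have hle : S.filter (· ≤ x) = S.filter (· < x) := by
    ext c
    simp only [Finset.mem_filter]
    constructor
    · rintro ⟨a, b⟩
      exact ⟨a, lt_of_le_of_ne b (fun h => hxS (h ▸ a))⟩
    · rintro ⟨a, b⟩; exact ⟨a, b.le⟩
  refine ⟨dom_of_cd hcd', fun i h1 h2 hlt => ?_⟩
  have hi : i ≤ (T.filter (· < x)).card := by
    have h3 := count_le_mem S (nth_mem' S i h1 h2)
    have h4 := nth_count S i h1 h2
    have h5 := count_le_lt S hlt
    omega
  exact ⟨nth_tri S T x hcd (by rw [hle, hc]) i h1 hi,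
    nth_tri _ T x hcd' (by rw [hge x le_rfl, hle, hc]) i h1 hi⟩
end
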